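/- Let J = diag(1,-1,1,1,-1,1), E₃ the 3×3 exchange matrix, and Q = (√2/2)[[I₃, E₃],[-E₃, I₃]] ∈ M₆(ℝ). Then Q is J-orthogonal (Qᵀ J Q = J), and for the 6×6 centrosymmetric tridiagonal matrix A with diagonal (a,-a,a,a,-a,a) (a real), superdiagonal (b₁,b₂,b₃,b₄,b₅), subdiagonal (b₅,b₄,b₃,b₂,b₁), the matrix Q^# A Q is block diagonal, equal to [[a,b₁,0],[b₅,-a,b₂],[0,b₄,a-b₃]] ⊕ [[a+b₃,b₄,0],[b₂,-a,b₅],[0,b₁,a]]. -/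

import Mathlib

open Matrix Real Complex

theorem stmt16 (a : ℝ) (b₁ b₂ b₃ b₄ b₅ : ℂ)
    (A : Matrix (Fin 6) (Fin 6) ℂ)
    (hA : A = !![(a : ℂ), b₁, 0, 0, 0, 0;
                 b₅, -(a : ℂ), b₂, 0, 0, 0;
                 0, b₄, (a : ℂ), b₃, 0, 0;
                 0, 0, b₃, (a : ℂ), b₄, 0;
                 0, 0, 0, b₂, -(a : ℂ), b₅;
                 0, 0, 0, 0, b₁, (a : ℂ)])
    (J : Matrix (Fin 6) (Fin 6) ℂ)
    (hJ : J = Matrix.diagonal ![1, -1, 1, 1, -1, 1])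
    (Q : Matrix (Fin 6) (Fin 6) ℂ)
    (hQ : Q = ((Real.sqrt 2 / 2 : ℝ) : ℂ) •
      !![1, 0, 0, 0, 0, 1;
         0, 1, 0, 0, 1, 0;
         0, 0, 1, 1, 0, 0;
         0, 0, -1, 1, 0, 0;
         0, -1, 0, 0, 1, 0;
         -1, 0, 0, 0, 0, 1]) :
    Qᵀ * J * Q = J ∧
    J * Qᴴ * J * A * Q
      = !![(a : ℂ), b₁, 0, 0, 0, 0;
           b₅, -(a : ℂ), b₂, 0, 0, 0;
           0, b₄, (a : ℂ) - b₃, 0, 0, 0;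
           0, 0, 0, (a : ℂ) + b₃, b₄, 0;
           0, 0, 0, b₂, -(a : ℂ), b₅;
           0, 0, 0, 0, b₁, (a : ℂ)] := by
  have hc : (((Real.sqrt 2 / 2 : ℝ) : ℂ)) * ((Real.sqrt 2 / 2 : ℝ) : ℂ) = 1 / 2 := by
    rw [← Complex.ofReal_mul]
    have h : Real.sqrt 2 / 2 * (Real.sqrt 2 / 2) = 1 / 2 := by
      have := Real.mul_self_sqrt (show (0 : ℝ) ≤ 2 by norm_num)
      linarith
    rw [h]
    norm_num
  have hs : star (((Real.sqrt 2 / 2 : ℝ) : ℂ)) = ((Real.sqrt 2 / 2 : ℝ) : ℂ) :=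
    Complex.conj_ofReal _
  generalize ((Real.sqrt 2 / 2 : ℝ) : ℂ) = c at hQ hc hs
  generalize (a : ℂ) = x at hA ⊢
  subst hA hJ hQ
  rw [Matrix.conjTranspose_smul, Matrix.transpose_smul, hs]
  simp only [Matrix.smul_mul, Matrix.mul_smul, smul_smul, hc]
  have h1 : (Matrix.diagonal ![1, -1, 1, 1, -1, 1] : Matrix (Fin 6) (Fin 6) ℂ) *
      (!![1, 0, 0, 0, 0, 1;
         0, 1, 0, 0, 1, 0;
         0, 0, 1, 1, 0, 0;
         0, 0, -1, 1, 0, 0;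
         0, -1, 0, 0, 1, 0;
         -1, 0, 0, 0, 0, 1] : Matrix (Fin 6) (Fin 6) ℂ)ᴴ * Matrix.diagonal ![1, -1, 1, 1, -1, 1] =
      !![1, 0, 0, 0, 0, -1;
         0, 1, 0, 0, -1, 0;
         0, 0, 1, -1, 0, 0;
         0, 0, 1, 1, 0, 0;
         0, 1, 0, 0, 1, 0;
         1, 0, 0, 0, 0, 1] := by
    ext i j
    rw [Matrix.mul_diagonal, Matrix.diagonal_mul, Matrix.conjTranspose_apply]
    fin_cases i <;> fin_cases j <;> simp
  rw [h1]
  constructor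
  · ext i j
    rw [Matrix.smul_apply, Matrix.mul_apply]
    simp only [Matrix.mul_diagonal, Fin.sum_univ_six, Matrix.transpose_apply]
    fin_cases i <;> fin_cases j <;> simp <;> norm_num
  · ext i j
    rw [Matrix.smul_apply, Matrix.mul_apply]
    simp only [Matrix.mul_apply, Fin.sum_univ_six]
    fin_cases i <;> fin_cases j <;> simp <;> ring
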